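/- arXiv:2011.00495 — 2 statements merged into one kernel-verified Lean document; each statement's English description precedes it below -/
import Mathlib

section
/- Assume β, h > 0 satisfy the AT-line condition β² E[cosh^{−4}(βz√q + h)] ≤ 1, where q = q_{β,h} and z is standard Gaussian. Then the map Δ sends [−q,q] into [−q,q] (indeed |Δ(t)| ≤ q for all t ∈ [−q,q]), Δ(q) = q, Δ is differentiable on (−q,q) with 0 < Δ′(t) < 1 for all t ∈ (−q,q), and t < Δ(t) for all t ∈ [−q,q). -/
open MeasureTheory ProbabilityTheory

noncomputable section

namespace CT

/-- the fixed point equation characterizing `q_{β,h}`. -/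
def qEq (β h q : ℝ) : Prop :=
  q = ∫ z, (Real.tanh (β * z * Real.sqrt q + h)) ^ 2 ∂(gaussianReal 0 1)

/-- the auxiliary function `Γ(t; γ, γ')`, with `Th(x) = tanh(x + h)`. -/
def Gam (β h : ℝ) (t γ γ' : ℝ) : ℝ :=
  ∫ z, ∫ z1, ∫ z2,
      Real.tanh (β * z * Real.sqrt (γ * |t|) + β * z1 * Real.sqrt (γ * (1 - |t|)) + h)
        * Real.tanh (β * Real.sign t * z * Real.sqrt (γ' * |t|)
            + β * z2 * Real.sqrt (γ' * (1 - |t|)) + h)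
      ∂(gaussianReal 0 1) ∂(gaussianReal 0 1) ∂(gaussianReal 0 1)

/-- `Δ(t) = Γ(t/q; q, q)`. -/
def Del (β h q : ℝ) (t : ℝ) : ℝ := Gam β h (t / q) q q

lemma charFunDual_stdGaussianReal (L : StrongDual ℝ ℝ) :
    charFunDual (gaussianReal 0 1) L = Complex.exp (-((L 1 : ℝ) : ℂ) ^ 2 / 2) := by
  rw [charFunDual_eq_charFun_map_one, gaussianReal_map_continuousLinearMap, charFun_gaussianReal]
  simp [neg_div, max_eq_left (sq_nonneg (L 1))]

lemma map_gaussian_triple_eq {a b c d s e : ℝ} (hab : a ^ 2 + b ^ 2 = 1) (hcd : c ^ 2 + d ^ 2 = 1)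
    (hac : a * c = s) (hse : s ^ 2 + e ^ 2 = 1) :
    ((gaussianReal 0 1).prod ((gaussianReal 0 1).prod (gaussianReal 0 1))).map
      (fun p : ℝ × ℝ × ℝ => (a * p.1 + b * p.2.1, c * p.1 + d * p.2.2)) =
    ((gaussianReal 0 1).prod (gaussianReal 0 1)).map
      (fun p : ℝ × ℝ => (p.1, s * p.1 + e * p.2)) := by
  let A : ℝ × ℝ × ℝ →L[ℝ] ℝ × ℝ :=
    (a • ContinuousLinearMap.fst ℝ ℝ (ℝ × ℝ) + b • (ContinuousLinearMap.fst ℝ ℝ ℝ).comp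
      (ContinuousLinearMap.snd ℝ ℝ (ℝ × ℝ))).prod
    (c • ContinuousLinearMap.fst ℝ ℝ (ℝ × ℝ) + d • (ContinuousLinearMap.snd ℝ ℝ ℝ).comp
      (ContinuousLinearMap.snd ℝ ℝ (ℝ × ℝ)))
  let B : ℝ × ℝ →L[ℝ] ℝ × ℝ :=
    (ContinuousLinearMap.fst ℝ ℝ ℝ).prod
      (s • ContinuousLinearMap.fst ℝ ℝ ℝ + e • ContinuousLinearMap.snd ℝ ℝ ℝ)
  change Measure.map A _ = Measure.map B _
  have : IsProbabilityMeasure (Measure.map A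
      ((gaussianReal 0 1).prod ((gaussianReal 0 1).prod (gaussianReal 0 1)))) :=
    Measure.isProbabilityMeasure_map (by fun_prop)
  have : IsProbabilityMeasure (Measure.map B ((gaussianReal 0 1).prod (gaussianReal 0 1))) :=
    Measure.isProbabilityMeasure_map (by fun_prop)
  refine Measure.ext_of_charFunDual (funext fun L => ?_)
  obtain ⟨u, v, hL⟩ : ∃ u v : ℝ, ∀ x y : ℝ, L (x, y) = x * u + y * v := by
    refine ⟨L (1, 0), L (0, 1), fun x y => ?_⟩
    rw [← smul_eq_mul, ← smul_eq_mul, ← map_smul, ← map_smul, ← map_add]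
    simp
  rw [charFunDual_map, charFunDual_map, charFunDual_prod, charFunDual_prod, charFunDual_prod]
  simp only [charFunDual_stdGaussianReal, ← Complex.exp_add]
  congr 1
  simp [A, B, hL]
  norm_cast
  subst hac
  linear_combination -(u^2/2) * hab - v^2/2 * hcd + v^2/2 * hse

lemma map_gaussian_pair_eq {s e : ℝ} (hse : s ^ 2 + e ^ 2 = 1) :
    ((gaussianReal 0 1).prod (gaussianReal 0 1)).map
      (fun p : ℝ × ℝ => s * p.1 + e * p.2) = gaussianReal 0 1 := by
  let B : ℝ × ℝ →L[ℝ] ℝ :=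
      (s • ContinuousLinearMap.fst ℝ ℝ ℝ + e • ContinuousLinearMap.snd ℝ ℝ ℝ)
  change Measure.map B _ = _
  have : IsProbabilityMeasure (Measure.map B ((gaussianReal 0 1).prod (gaussianReal 0 1))) :=
    Measure.isProbabilityMeasure_map (by fun_prop)
  refine Measure.ext_of_charFunDual (funext fun L => ?_)
  have hL (x : ℝ) : L x = x * L 1 := by
    rw [← smul_eq_mul, ← map_smul]
    simp
  rw [charFunDual_map, charFunDual_prod]
  simp only [charFunDual_stdGaussianReal, ← Complex.exp_add]
  congr 1
  have hs := hL s
  have he := hL e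
  simp only [ContinuousLinearMap.coe_comp, Function.comp_apply, B] at hs he ⊢
  simp [hs, he]
  norm_cast
  linear_combination -((L 1)^2/2) * hse

lemma hasDerivAt_gaussianPDFReal_std (x : ℝ) :
    HasDerivAt (gaussianPDFReal 0 1) (-(x * gaussianPDFReal 0 1 x)) x := by
  have h : HasDerivAt (fun x : ℝ => -x ^ 2 / 2) (-x) x := by
    have := ((hasDerivAt_id x).pow 2).neg.div_const 2
    refine this.congr_deriv ?_
    simp
    ring
  have h2 := (h.exp).const_mul (√(2 * Real.pi))⁻¹
  have h3 : gaussianPDFReal 0 1 = fun x => (√(2 * Real.pi))⁻¹ * Real.exp (-x ^ 2 / 2) := by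
    funext y; simp [gaussianPDFReal]
  rw [h3]
  refine h2.congr_deriv ?_
  ring

lemma integrable_id_std : Integrable (fun x : ℝ => x) (gaussianReal 0 1) :=
  (memLp_id_gaussianReal 1).integrable le_rfl

/-- Stein's lemma: Gaussian integration by parts. -/
lemma integral_mul_gaussianReal_eq_integral_deriv {f f' : ℝ → ℝ} {C C' : ℝ}
    (hf : ∀ x, HasDerivAt f (f' x) x) (hf' : Continuous f')
    (hC : ∀ x, |f x| ≤ C) (hC' : ∀ x, |f' x| ≤ C') :
    ∫ x, x * f x ∂(gaussianReal 0 1) = ∫ x, f' x ∂(gaussianReal 0 1) := by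
  have hcf : Continuous f := continuous_iff_continuousAt.2 fun x => (hf x).continuousAt
  have hint : Integrable (gaussianPDFReal 0 1) := integrable_gaussianPDFReal 0 1
  have hint' : Integrable (fun x => x * gaussianPDFReal 0 1 x) := by
    have := integrable_id_std
    rw [gaussianReal_of_var_ne_zero 0 one_ne_zero,
      integrable_withDensity_iff (measurable_gaussianPDF 0 1)
        (ae_of_all _ fun _ => gaussianPDF_lt_top)] at this
    simpa [toReal_gaussianPDF] using this
  have key := integral_mul_deriv_eq_deriv_mul_of_integrable (u := f) (v := gaussianPDFReal 0 1)
    (u' := f') (v' := fun x => -(x * gaussianPDFReal 0 1 x)) (fun x _ => hf x)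
    (fun x _ => hasDerivAt_gaussianPDFReal_std x)
    (hint'.neg.bdd_mul (c := C) hcf.aestronglyMeasurable (.of_forall hC))
    (hint.bdd_mul (c := C') hf'.aestronglyMeasurable (.of_forall hC'))
    (hint.bdd_mul (c := C) hcf.aestronglyMeasurable (.of_forall hC))
  rw [integral_gaussianReal_eq_integral_smul one_ne_zero,
    integral_gaussianReal_eq_integral_smul one_ne_zero]
  simp only [smul_eq_mul]
  calc ∫ x, gaussianPDFReal 0 1 x * (x * f x)
      = -∫ x, f x * -(x * gaussianPDFReal 0 1 x) := by
        rw [← integral_neg]; congr 1; funext x; ring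
    _ = ∫ x, gaussianPDFReal 0 1 x * f' x := by
        rw [key, neg_neg]; congr 1; funext x; ring

local notation "γ₁" => gaussianReal 0 1

local notation "γ₂" => Measure.prod (gaussianReal 0 1) (gaussianReal 0 1)

lemma integrable_of_continuous_of_abs_le {X : Type*} [TopologicalSpace X] [MeasurableSpace X]
    [OpensMeasurableSpace X] [SecondCountableTopology X] {μ : Measure X} [IsFiniteMeasure μ]
    {f : X → ℝ} {C : ℝ} (hf : Continuous f) (hC : ∀ x, |f x| ≤ C) : Integrable f μ :=
  Integrable.of_bound hf.aestronglyMeasurable C (.of_forall hC)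

lemma integrable_fst_std : Integrable (fun p : ℝ × ℝ => p.1) γ₂ :=
  integrable_id_std.comp_fst _

lemma integrable_snd_std : Integrable (fun p : ℝ × ℝ => p.2) γ₂ :=
  integrable_id_std.comp_snd _

lemma integrable_fst_mul {F : ℝ × ℝ → ℝ} {C : ℝ} (hF : Continuous F) (hC : ∀ p, |F p| ≤ C) :
    Integrable (fun p : ℝ × ℝ => p.1 * F p) γ₂ :=
  integrable_fst_std.mul_bdd hF.aestronglyMeasurable (.of_forall hC)

lemma integrable_snd_mul {F : ℝ × ℝ → ℝ} {C : ℝ} (hF : Continuous F) (hC : ∀ p, |F p| ≤ C) :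
    Integrable (fun p : ℝ × ℝ => p.2 * F p) γ₂ :=
  integrable_snd_std.mul_bdd hF.aestronglyMeasurable (.of_forall hC)

lemma integral_fst_mul_eq_integral_deriv {F F' : ℝ × ℝ → ℝ} {C C' : ℝ}
    (hd : ∀ x y, HasDerivAt (fun u => F (u, y)) (F' (x, y)) x)
    (hF : Continuous F) (hF' : Continuous F')
    (hC : ∀ p, |F p| ≤ C) (hC' : ∀ p, |F' p| ≤ C') :
    ∫ p, p.1 * F p ∂γ₂ = ∫ p, F' p ∂γ₂ := by
  rw [integral_prod_symm _ (integrable_fst_mul hF hC),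
    integral_prod_symm _ (integrable_of_continuous_of_abs_le hF' hC')]
  congr 1
  funext y
  exact integral_mul_gaussianReal_eq_integral_deriv (fun x => hd x y) (by fun_prop)
    (fun x => hC (x, y)) (fun x => hC' (x, y))

lemma integral_snd_mul_eq_integral_deriv {F F' : ℝ × ℝ → ℝ} {C C' : ℝ}
    (hd : ∀ x y, HasDerivAt (fun u => F (x, u)) (F' (x, y)) y)
    (hF : Continuous F) (hF' : Continuous F')
    (hC : ∀ p, |F p| ≤ C) (hC' : ∀ p, |F' p| ≤ C') :
    ∫ p, p.2 * F p ∂γ₂ = ∫ p, F' p ∂γ₂ := by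
  rw [integral_prod _ (integrable_snd_mul hF hC),
    integral_prod _ (integrable_of_continuous_of_abs_le hF' hC')]
  congr 1
  funext x
  exact integral_mul_gaussianReal_eq_integral_deriv (fun y => hd x y) (by fun_prop)
    (fun y => hC (x, y)) (fun y => hC' (x, y))

instance : Measure.IsOpenPosMeasure γ₁ :=
  (gaussianReal_absolutelyContinuous' 0 one_ne_zero).isOpenPosMeasure

lemma integral_comp_rotate_std {s e : ℝ} (hse : s ^ 2 + e ^ 2 = 1) {f : ℝ → ℝ}
    (hf : Continuous f) :
    ∫ p, f (s * p.1 + e * p.2) ∂γ₂ = ∫ x, f x ∂γ₁ := by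
  conv_rhs => rw [← map_gaussian_pair_eq hse]
  rw [integral_map (by fun_prop) hf.aestronglyMeasurable]

lemma integral_comp_fst_std (f : ℝ → ℝ) : ∫ p, f p.1 ∂γ₂ = ∫ x, f x ∂γ₁ := by
  rw [integral_fun_fst]
  simp

/-- For bounded continuous `f`, the covariance-type integral of `f` against a correlated Gaussian
pair is at most the second moment of `f` in absolute value. -/
lemma abs_integral_mul_rotate_le {s e C : ℝ} (hse : s ^ 2 + e ^ 2 = 1) {f : ℝ → ℝ}
    (hf : Continuous f) (hC : ∀ x, |f x| ≤ C) :
    |∫ p, f p.1 * f (s * p.1 + e * p.2) ∂γ₂| ≤ ∫ x, f x ^ 2 ∂γ₁ := by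
  have hsq (x : ℝ) : |f x ^ 2| ≤ C ^ 2 := by
    rw [abs_pow]
    exact pow_le_pow_left₀ (abs_nonneg _) (hC x) 2
  have h1 : Integrable (fun p : ℝ × ℝ => f p.1 ^ 2) γ₂ :=
    integrable_of_continuous_of_abs_le (by fun_prop) (fun p => hsq p.1)
  have h2 : Integrable (fun p : ℝ × ℝ => f (s * p.1 + e * p.2) ^ 2) γ₂ :=
    integrable_of_continuous_of_abs_le (by fun_prop) (fun p => hsq _)
  calc |∫ p, f p.1 * f (s * p.1 + e * p.2) ∂γ₂|
      ≤ ∫ p, |f p.1 * f (s * p.1 + e * p.2)| ∂γ₂ := abs_integral_le_integral_abs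
    _ ≤ ∫ p, (f p.1 ^ 2 + f (s * p.1 + e * p.2) ^ 2) / 2 ∂γ₂ := by
        refine integral_mono_of_nonneg (.of_forall fun _ => abs_nonneg _)
          ((h1.add h2).div_const 2) (.of_forall fun p => ?_)
        change |f p.1 * f (s * p.1 + e * p.2)| ≤ (f p.1 ^ 2 + f (s * p.1 + e * p.2) ^ 2) / 2
        rw [abs_le]
        constructor <;>
        nlinarith [sq_nonneg (f p.1 + f (s * p.1 + e * p.2)),
          sq_nonneg (f p.1 - f (s * p.1 + e * p.2))]
    _ = ∫ x, f x ^ 2 ∂γ₁ := by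
        rw [integral_div, integral_add h1 h2, integral_comp_fst_std (fun x => f x ^ 2),
          integral_comp_rotate_std hse (f := fun x => f x ^ 2) (by fun_prop)]
        ring

/-- Strict Cauchy-Schwarz inequality for a nonconstant function of a Gaussian pair whose
correlation is not `±1`. -/
lemma integral_mul_rotate_lt {s e C : ℝ} (hse : s ^ 2 + e ^ 2 = 1) (he : e ≠ 0) {f : ℝ → ℝ}
    (hf : Continuous f) (hC : ∀ x, |f x| ≤ C) (hne : ∃ x y, f x ≠ f y) :
    ∫ p, f p.1 * f (s * p.1 + e * p.2) ∂γ₂ < ∫ x, f x ^ 2 ∂γ₁ := by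
  have hsq (x : ℝ) : |f x ^ 2| ≤ C ^ 2 := by
    rw [abs_pow]
    exact pow_le_pow_left₀ (abs_nonneg _) (hC x) 2
  have h1 : Integrable (fun p : ℝ × ℝ => f p.1 ^ 2) γ₂ :=
    integrable_of_continuous_of_abs_le (by fun_prop) (fun p => hsq p.1)
  have h2 : Integrable (fun p : ℝ × ℝ => f (s * p.1 + e * p.2) ^ 2) γ₂ :=
    integrable_of_continuous_of_abs_le (by fun_prop) (fun p => hsq _)
  have h3 : Integrable (fun p : ℝ × ℝ => f p.1 * f (s * p.1 + e * p.2)) γ₂ := by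
    refine integrable_of_continuous_of_abs_le (C := C * C) (by fun_prop) (fun p => ?_)
    rw [abs_mul]
    exact mul_le_mul (hC _) (hC _) (abs_nonneg _) ((abs_nonneg _).trans (hC 0))
  have h4 : Integrable (fun p : ℝ × ℝ => (f p.1 - f (s * p.1 + e * p.2)) ^ 2) γ₂ := by
    refine ((h1.add h2).sub (h3.const_mul 2)).congr (.of_forall fun p => ?_)
    simp only [Pi.add_apply, Pi.sub_apply]
    ring
  obtain ⟨x, y, hxy⟩ := hne
  have hpos : 0 < ∫ p, (f p.1 - f (s * p.1 + e * p.2)) ^ 2 ∂γ₂ := by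
    refine integral_pos_of_integrable_nonneg_nonzero (x := (x, (y - s * x) / e)) (by fun_prop) h4
      (fun p => sq_nonneg _) ?_
    have : s * x + e * ((y - s * x) / e) = y := by field_simp; ring
    simpa [this, sub_eq_zero] using hxy
  have hexp : ∫ p, (f p.1 - f (s * p.1 + e * p.2)) ^ 2 ∂γ₂ =
      2 * ∫ x, f x ^ 2 ∂γ₁ - 2 * ∫ p, f p.1 * f (s * p.1 + e * p.2) ∂γ₂ := by
    have : ∀ p : ℝ × ℝ, (f p.1 - f (s * p.1 + e * p.2)) ^ 2 =
        (f p.1 ^ 2 + f (s * p.1 + e * p.2) ^ 2) - 2 * (f p.1 * f (s * p.1 + e * p.2)) :=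
      fun p => by ring
    simp only [this]
    rw [integral_sub (f := fun p : ℝ × ℝ => f p.1 ^ 2 + f (s * p.1 + e * p.2) ^ 2) (h1.add h2)
      (h3.const_mul 2), integral_add h1 h2, integral_const_mul,
      integral_comp_fst_std (fun x => f x ^ 2),
      integral_comp_rotate_std hse (f := fun x => f x ^ 2) (by fun_prop)]
    ring
  linarith

lemma hasDerivAt_tanh (x : ℝ) : HasDerivAt Real.tanh (1 - Real.tanh x ^ 2) x := by
  have hc : Real.cosh x ≠ 0 := (Real.cosh_pos x).ne'
  have h := (Real.hasDerivAt_sinh x).div (Real.hasDerivAt_cosh x) hc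
  have h2 : Real.tanh = Real.sinh / Real.cosh := funext Real.tanh_eq_sinh_div_cosh
  rw [h2]
  refine h.congr_deriv ?_
  simp only [Pi.div_apply]
  field_simp

lemma one_sub_tanh_sq (x : ℝ) : 1 - Real.tanh x ^ 2 = 1 / Real.cosh x ^ 2 := by
  have hc : Real.cosh x ≠ 0 := (Real.cosh_pos x).ne'
  rw [Real.tanh_eq_sinh_div_cosh]
  field_simp
  linarith [Real.cosh_sq x]

/-- The function `x ↦ tanh (a x + h)`. -/
def affTanh (a h x : ℝ) : ℝ := Real.tanh (a * x + h)

/-- The function `x ↦ cosh⁻² (a x + h)`, written through `tanh`. -/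
def affSech2 (a h x : ℝ) : ℝ := 1 - affTanh a h x ^ 2

section affTanh

variable (a h : ℝ)

lemma hasDerivAt_affTanh (x : ℝ) : HasDerivAt (affTanh a h) (a * affSech2 a h x) x := by
  have h1 : HasDerivAt (fun x : ℝ => a * x + h) a x := by
    simpa using ((hasDerivAt_id x).const_mul a).add_const h
  refine ((hasDerivAt_tanh (a * x + h)).comp x h1).congr_deriv ?_
  rw [affSech2, affTanh]
  ring

lemma hasDerivAt_affSech2 (x : ℝ) :
    HasDerivAt (affSech2 a h) (-2 * a * (affTanh a h x * affSech2 a h x)) x := by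
  refine (((hasDerivAt_affTanh a h x).pow 2).const_sub 1).congr_deriv ?_
  simp
  ring

@[fun_prop]
lemma continuous_affTanh : Continuous (affTanh a h) :=
  continuous_iff_continuousAt.2 fun x => (hasDerivAt_affTanh a h x).continuousAt

@[fun_prop]
lemma continuous_affSech2 : Continuous (affSech2 a h) :=
  continuous_iff_continuousAt.2 fun x => (hasDerivAt_affSech2 a h x).continuousAt

lemma abs_affTanh_le (x : ℝ) : |affTanh a h x| ≤ 1 := (Real.abs_tanh_lt_one _).le

lemma affSech2_pos (x : ℝ) : 0 < affSech2 a h x := sub_pos.2 (Real.tanh_sq_lt_one _)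

lemma abs_affSech2_le (x : ℝ) : |affSech2 a h x| ≤ 1 := by
  rw [abs_of_pos (affSech2_pos a h x), affSech2]
  linarith [sq_nonneg (affTanh a h x)]

lemma affSech2_sq (x : ℝ) : affSech2 a h x ^ 2 = 1 / Real.cosh (a * x + h) ^ 4 := by
  rw [affSech2, affTanh, one_sub_tanh_sq, div_pow, one_pow, ← pow_mul]

lemma exists_affSech2_ne (ha : a ≠ 0) : ∃ x y, affSech2 a h x ≠ affSech2 a h y := by
  refine ⟨-h / a, (1 - h) / a, fun hxy => ?_⟩
  have h0 : a * (-h / a) + h = 0 := by field_simp; ring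
  have h1 : a * ((1 - h) / a) + h = 1 := by field_simp; ring
  rw [affSech2, affSech2, affTanh, affTanh, h0, h1, Real.tanh_zero] at hxy
  have h2 : Real.tanh 1 = 0 := by
    have : Real.tanh 1 ^ 2 = 0 := by linarith
    simpa using this
  rw [Real.tanh_eq_sinh_div_cosh, div_eq_zero_iff] at h2
  rcases h2 with h2 | h2
  · exact one_ne_zero (Real.sinh_eq_zero.1 h2)
  · exact (Real.cosh_pos 1).ne' h2

/-- The correlation of `affTanh a h` at two standard Gaussians with correlation `sin θ`. -/
def angleCorr (θ : ℝ) : ℝ :=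
  ∫ p, affTanh a h p.1 * affTanh a h (Real.sin θ * p.1 + Real.cos θ * p.2) ∂γ₂

lemma hasDerivAt_angleCorr_of_dominated (θ : ℝ) :
    HasDerivAt (angleCorr a h)
      (∫ p, affTanh a h p.1 * (a * affSech2 a h (Real.sin θ * p.1 + Real.cos θ * p.2) *
        (Real.cos θ * p.1 - Real.sin θ * p.2)) ∂γ₂) θ := by
  have hbound : Integrable (fun p : ℝ × ℝ => |a| * (|p.1| + |p.2|)) γ₂ :=
    (integrable_fst_std.abs.add integrable_snd_std.abs).const_mul _
  refine (hasDerivAt_integral_of_dominated_loc_of_deriv_le (s := Set.univ)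
    (F := fun θ (p : ℝ × ℝ) =>
      affTanh a h p.1 * affTanh a h (Real.sin θ * p.1 + Real.cos θ * p.2))
    (F' := fun θ (p : ℝ × ℝ) =>
      affTanh a h p.1 * (a * affSech2 a h (Real.sin θ * p.1 + Real.cos θ * p.2) *
        (Real.cos θ * p.1 - Real.sin θ * p.2)))
    Filter.univ_mem (.of_forall fun φ => ?_) ?_ ?_ (.of_forall fun p φ _ => ?_) hbound
    (.of_forall fun p φ _ => ?_)).2
  · exact Continuous.aestronglyMeasurable (by fun_prop)
  · refine integrable_of_continuous_of_abs_le (C := 1) (by fun_prop) fun p => ?_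
    rw [abs_mul]
    exact mul_le_one₀ (abs_affTanh_le _ _ _) (abs_nonneg _) (abs_affTanh_le _ _ _)
  · exact Continuous.aestronglyMeasurable (by fun_prop)
  · rw [Real.norm_eq_abs, abs_mul, abs_mul, abs_mul]
    have h1 : |Real.cos φ * p.1 - Real.sin φ * p.2| ≤ |p.1| + |p.2| := by
      refine (abs_sub _ _).trans (add_le_add ?_ ?_)
      · rw [abs_mul]
        exact mul_le_of_le_one_left (abs_nonneg _) (Real.abs_cos_le_one φ)
      · rw [abs_mul]
        exact mul_le_of_le_one_left (abs_nonneg _) (Real.abs_sin_le_one φ)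
    have h2 : |a| * |affSech2 a h (Real.sin φ * p.1 + Real.cos φ * p.2)| ≤ |a| :=
      mul_le_of_le_one_right (abs_nonneg _) (abs_affSech2_le _ _ _)
    refine (mul_le_of_le_one_left (by positivity) (abs_affTanh_le _ _ _)).trans ?_
    exact mul_le_mul h2 h1 (abs_nonneg _) (abs_nonneg _)
  · have hin : HasDerivAt (fun φ => Real.sin φ * p.1 + Real.cos φ * p.2)
        (Real.cos φ * p.1 - Real.sin φ * p.2) φ := by
      refine (((Real.hasDerivAt_sin φ).mul_const p.1).add
        ((Real.hasDerivAt_cos φ).mul_const p.2)).congr_deriv ?_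
      ring
    exact ((hasDerivAt_affTanh a h _).comp φ hin).const_mul _

lemma hasDerivAt_angleCorr (θ : ℝ) :
    HasDerivAt (angleCorr a h)
      (Real.cos θ * (a ^ 2 * ∫ p, affSech2 a h p.1 *
        affSech2 a h (Real.sin θ * p.1 + Real.cos θ * p.2) ∂γ₂)) θ := by
  refine (hasDerivAt_angleCorr_of_dominated a h θ).congr_deriv ?_
  set s := Real.sin θ
  set c := Real.cos θ
  let F : ℝ × ℝ → ℝ := fun p => affTanh a h p.1 * (a * affSech2 a h (s * p.1 + c * p.2))
  let K : ℝ × ℝ → ℝ := fun p => affSech2 a h p.1 * affSech2 a h (s * p.1 + c * p.2)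
  let M : ℝ × ℝ → ℝ := fun p => affTanh a h p.1 *
    (-2 * a ^ 2 * (affTanh a h (s * p.1 + c * p.2) * affSech2 a h (s * p.1 + c * p.2)))
  have hFc : Continuous F := by fun_prop
  have hKc : Continuous K := by fun_prop
  have hMc : Continuous M := by fun_prop
  have hT := abs_affTanh_le a h
  have hS := abs_affSech2_le a h
  have hFb (p) : |F p| ≤ |a| := by
    simp only [F, abs_mul]
    exact (mul_le_of_le_one_left (by positivity) (hT _)).trans
      (mul_le_of_le_one_right (abs_nonneg _) (hS _))
  have hKb (p) : |K p| ≤ 1 := by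
    simp only [K, abs_mul]
    exact mul_le_one₀ (hS _) (abs_nonneg _) (hS _)
  have hMb (p) : |M p| ≤ |-2 * a ^ 2| := by
    simp only [M]
    rw [abs_mul, abs_mul, abs_mul (affTanh a h _)]
    exact (mul_le_of_le_one_left (by positivity) (hT _)).trans
      (mul_le_of_le_one_right (abs_nonneg _) (mul_le_one₀ (hT _) (abs_nonneg _) (hS _)))
  have hKi : Integrable K γ₂ := integrable_of_continuous_of_abs_le hKc hKb
  have hMi : Integrable M γ₂ := integrable_of_continuous_of_abs_le hMc hMb
  have h1 : ∫ p, p.1 * F p ∂γ₂ = ∫ p, (a ^ 2 * K p + s * M p) ∂γ₂ := by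
    refine integral_fst_mul_eq_integral_deriv (C := |a|) (C' := a ^ 2 * 1 + |s| * |-2 * a ^ 2|)
      (fun x y => ?_) hFc (by fun_prop) hFb (fun p => ?_)
    · have hin : HasDerivAt (fun u => s * u + c * y) s x := by
        simpa using ((hasDerivAt_id x).const_mul s).add_const (c * y)
      refine ((hasDerivAt_affTanh a h x).mul
        (((hasDerivAt_affSech2 a h _).comp x hin).const_mul a)).congr_deriv ?_
      simp only [K, M, Function.comp_apply]
      ring
    · refine (abs_add_le _ _).trans (add_le_add ?_ ?_)
      · rw [abs_mul, abs_of_nonneg (sq_nonneg a)]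
        exact mul_le_mul_of_nonneg_left (hKb p) (sq_nonneg a)
      · rw [abs_mul]
        exact mul_le_mul_of_nonneg_left (hMb p) (abs_nonneg _)
  have h2 : ∫ p, p.2 * F p ∂γ₂ = ∫ p, c * M p ∂γ₂ := by
    refine integral_snd_mul_eq_integral_deriv (C := |a|) (C' := |c| * |-2 * a ^ 2|)
      (fun x y => ?_) hFc (by fun_prop) hFb (fun p => ?_)
    · have hin : HasDerivAt (fun u => s * x + c * u) c y := by
        simpa using ((hasDerivAt_id y).const_mul c).const_add (s * x)
      refine ((((hasDerivAt_affSech2 a h _).comp y hin).const_mul a).const_mul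
        (affTanh a h x)).congr_deriv ?_
      simp only [M]
      ring
    · rw [abs_mul]
      exact mul_le_mul_of_nonneg_left (hMb p) (abs_nonneg _)
  calc ∫ p, affTanh a h p.1 * (a * affSech2 a h (s * p.1 + c * p.2) * (c * p.1 - s * p.2)) ∂γ₂
      = ∫ p, (c * (p.1 * F p) - s * (p.2 * F p)) ∂γ₂ := by
        congr 1
        funext p
        simp only [F]
        ring
    _ = c * (a ^ 2 * ∫ p, K p ∂γ₂) := by
        rw [integral_sub ((integrable_fst_mul hFc hFb).const_mul c)
          ((integrable_snd_mul hFc hFb).const_mul s), integral_const_mul, integral_const_mul,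
          h1, h2, integral_add (hKi.const_mul _) (hMi.const_mul _), integral_const_mul,
          integral_const_mul, integral_const_mul]
        ring

end affTanh

lemma Gam_eq_angleCorr {β h q ρ : ℝ} (hq : 0 ≤ q) (hρ : |ρ| ≤ 1) :
    Gam β h ρ q q = angleCorr (β * √q) h (Real.arcsin ρ) := by
  have hρ' := abs_le.1 hρ
  set a := √|ρ|
  set b := √(1 - |ρ|)
  set c := Real.sign ρ * √|ρ|
  have ha2 : a ^ 2 = |ρ| := Real.sq_sqrt (abs_nonneg ρ)
  have hb2 : b ^ 2 = 1 - |ρ| := Real.sq_sqrt (by linarith)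
  have hac : a * c = ρ := by
    have : a * c = Real.sign ρ * a ^ 2 := by simp only [a, c]; ring
    rw [this, ha2]
    rcases lt_trichotomy ρ 0 with h0 | h0 | h0
    · rw [Real.sign_of_neg h0, abs_of_neg h0]; ring
    · simp [h0]
    · rw [Real.sign_of_pos h0, abs_of_pos h0, one_mul]
  have hc2 : c ^ 2 = |ρ| := by
    have : c ^ 2 = Real.sign ρ ^ 2 * a ^ 2 := by simp only [a, c]; ring
    rw [this, ha2]
    rcases lt_trichotomy ρ 0 with h0 | h0 | h0
    · rw [Real.sign_of_neg h0]; ring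
    · simp [h0]
    · rw [Real.sign_of_pos h0]; ring
  have hs : Real.sin (Real.arcsin ρ) = ρ := Real.sin_arcsin hρ'.1 hρ'.2
  let T := affTanh (β * √q) h
  have hTT : Continuous fun p : ℝ × ℝ => T p.1 * T p.2 := by fun_prop
  have hTb (x y : ℝ) : |T x * T y| ≤ 1 := by
    rw [abs_mul]
    exact mul_le_one₀ (abs_affTanh_le _ _ _) (abs_nonneg _) (abs_affTanh_le _ _ _)
  have hmap := map_gaussian_triple_eq (a := a) (b := b) (c := c) (d := b) (s := ρ)
    (e := Real.cos (Real.arcsin ρ)) (by rw [ha2, hb2]; ring) (by rw [hc2, hb2]; ring) hac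
    (by nlinarith [Real.sin_sq_add_cos_sq (Real.arcsin ρ)])
  have hint := congrArg (fun μ : Measure (ℝ × ℝ) => ∫ p, T p.1 * T p.2 ∂μ) hmap
  beta_reduce at hint
  rw [integral_map (by fun_prop) hTT.aestronglyMeasurable,
    integral_map (by fun_prop) hTT.aestronglyMeasurable] at hint
  rw [angleCorr, hs]
  refine Eq.trans ?_ hint
  rw [integral_prod _ (integrable_of_continuous_of_abs_le (C := 1) (by fun_prop)
    fun p => hTb _ _), Gam]
  congr 1
  funext z
  rw [integral_prod _ (integrable_of_continuous_of_abs_le (C := 1) (by fun_prop)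
    fun p => hTb _ _)]
  congr 1
  funext z1
  congr 1
  funext z2
  simp only [T, affTanh, Real.sqrt_mul hq, a, b, c]
  congr 2 <;> ring

lemma Del_eq_angleCorr {β h q t : ℝ} (hq : 0 < q) (ht : t ∈ Set.Icc (-q) q) :
    Del β h q t = angleCorr (β * √q) h (Real.arcsin (t / q)) := by
  refine Gam_eq_angleCorr hq.le ?_
  rw [abs_div, abs_of_pos hq, div_le_one hq]
  exact abs_le.2 ht

lemma qEq.pos {β h q : ℝ} (hh : 0 < h) (hq : qEq β h q) : 0 < q := by
  have h0 : 0 ≤ q := by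
    rw [hq]
    exact integral_nonneg fun _ => sq_nonneg _
  refine h0.lt_of_ne' fun hq0 => ?_
  rw [qEq, hq0] at hq
  have h1 : Real.tanh h = 0 := by simpa using hq.symm
  rw [Real.tanh_eq_sinh_div_cosh] at h1
  exact (div_pos (Real.sinh_pos_iff.2 hh) (Real.cosh_pos h)).ne' h1

lemma qEq.integral_affTanh_sq {β h q : ℝ} (hq : qEq β h q) :
    ∫ x, affTanh (β * √q) h x ^ 2 ∂γ₁ = q := by
  conv_rhs => rw [hq]
  simp only [affTanh, mul_right_comm]

lemma hasDerivAt_Del {β h q t : ℝ} (hq : 0 < q) (ht : t ∈ Set.Ioo (-q) q) :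
    HasDerivAt (Del β h q) (β ^ 2 * ∫ p, affSech2 (β * √q) h p.1 *
      affSech2 (β * √q) h (Real.sin (Real.arcsin (t / q)) * p.1 +
        Real.cos (Real.arcsin (t / q)) * p.2) ∂γ₂) t := by
  have h1 : -1 < t / q := by rw [lt_div_iff₀ hq]; linarith [ht.1]
  have h2 : t / q < 1 := by rw [div_lt_iff₀ hq]; linarith [ht.2]
  have hc : 0 < √(1 - (t / q) ^ 2) := Real.sqrt_pos.2 (by nlinarith)
  have harc : HasDerivAt (fun t => Real.arcsin (t / q)) (1 / √(1 - (t / q) ^ 2) * (1 / q)) t :=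
    (Real.hasDerivAt_arcsin h1.ne' h2.ne).comp t
      (h := fun t => t / q) ((hasDerivAt_id t).div_const q)
  have hcomp := (hasDerivAt_angleCorr (β * √q) h (Real.arcsin (t / q))).comp t harc
  refine (hcomp.congr_of_eventuallyEq ?_).congr_deriv ?_
  · filter_upwards [Ioo_mem_nhds ht.1 ht.2] with u hu
    exact Del_eq_angleCorr hq (Set.Ioo_subset_Icc_self hu)
  · generalize (∫ p, affSech2 (β * √q) h p.1 *
      affSech2 (β * √q) h (Real.sin (Real.arcsin (t / q)) * p.1 +
        Real.cos (Real.arcsin (t / q)) * p.2) ∂γ₂) = I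
    rw [Real.cos_arcsin, mul_pow, Real.sq_sqrt hq.le]
    generalize √(1 - (t / q) ^ 2) = r at hc
    field_simp

lemma continuousOn_Del {β h q : ℝ} (hq : 0 < q) :
    ContinuousOn (Del β h q) (Set.Icc (-q) q) := by
  have hc : Continuous (angleCorr (β * √q) h) :=
    continuous_iff_continuousAt.2 fun θ => (hasDerivAt_angleCorr _ _ θ).continuousAt
  have : Continuous fun t => angleCorr (β * √q) h (Real.arcsin (t / q)) :=
    hc.comp (Real.continuous_arcsin.comp (continuous_id.div_const q))
  exact this.continuousOn.congr fun t ht => Del_eq_angleCorr hq ht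

/-- **Properties of `Δ` inside the AT line** (Section 3.3): `Δ` maps `[−q,q]` into
itself, fixes `q`, is differentiable on `(−q,q)` with derivative strictly between `0`
and `1`, and satisfies `t < Δ(t)` for all `t ∈ [−q, q)`. -/
theorem Delta_properties
    (β h q : ℝ) (hβ : 0 < β) (hh : 0 < h)
    (hq : qEq β h q) (hquniq : ∀ q', qEq β h q' → q' = q)
    (hAT : β ^ 2 *
        ∫ z, 1 / (Real.cosh (β * z * Real.sqrt q + h)) ^ 4 ∂(gaussianReal 0 1) ≤ 1) :
    (∀ t ∈ Set.Icc (-q) q, |Del β h q t| ≤ q) ∧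
    Del β h q q = q ∧
    (∀ t ∈ Set.Ioo (-q) q, ∃ d : ℝ,
      HasDerivAt (Del β h q) d t ∧ 0 < d ∧ d < 1) ∧
    (∀ t ∈ Set.Ico (-q) q, t < Del β h q t) := by
  have hq0 : 0 < q := hq.pos hh
  have ha : β * √q ≠ 0 := (mul_pos hβ (Real.sqrt_pos.2 hq0)).ne'
  have hself : Del β h q q = q := by
    rw [Del_eq_angleCorr hq0 ⟨by linarith, le_rfl⟩, div_self hq0.ne', angleCorr,
      Real.sin_arcsin (by norm_num) le_rfl, Real.cos_arcsin]
    simp only [one_pow, sub_self, Real.sqrt_zero, one_mul, zero_mul, add_zero, ← pow_two]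
    rw [integral_comp_fst_std (fun x => affTanh (β * √q) h x ^ 2), hq.integral_affTanh_sq]
  have hderiv : ∀ t ∈ Set.Ioo (-q) q, ∃ d : ℝ, HasDerivAt (Del β h q) d t ∧ 0 < d ∧ d < 1 := by
    intro t ht
    refine ⟨_, hasDerivAt_Del hq0 ht, ?_, ?_⟩
    · refine mul_pos (by positivity) (integral_pos_of_integrable_nonneg_nonzero (x := (0, 0))
        (by fun_prop) (integrable_of_continuous_of_abs_le (C := 1) (by fun_prop) fun p => ?_)
        (fun p => (mul_pos (affSech2_pos _ _ _) (affSech2_pos _ _ _)).le)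
        (mul_pos (affSech2_pos _ _ _) (affSech2_pos _ _ _)).ne')
      rw [abs_mul]
      exact mul_le_one₀ (abs_affSech2_le _ _ _) (abs_nonneg _) (abs_affSech2_le _ _ _)
    · have hcos : Real.cos (Real.arcsin (t / q)) ≠ 0 := by
        have h1 : -1 < t / q := by rw [lt_div_iff₀ hq0]; linarith [ht.1]
        have h2 : t / q < 1 := by rw [div_lt_iff₀ hq0]; linarith [ht.2]
        rw [Real.cos_arcsin]
        exact (Real.sqrt_pos.2 (by nlinarith)).ne'
      refine (mul_lt_mul_of_pos_left (integral_mul_rotate_lt (Real.sin_sq_add_cos_sq _) hcos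
        (continuous_affSech2 _ _) (abs_affSech2_le _ _) (exists_affSech2_ne _ _ ha))
        (by positivity)).trans_le ?_
      simpa only [affSech2_sq, mul_right_comm] using hAT
  refine ⟨fun t ht => ?_, hself, hderiv, fun t ht => ?_⟩
  · rw [Del_eq_angleCorr hq0 ht]
    exact (abs_integral_mul_rotate_le (Real.sin_sq_add_cos_sq _) (continuous_affTanh _ _)
      (abs_affTanh_le _ _)).trans_eq hq.integral_affTanh_sq
  · choose! d hd using hderiv
    have hsub : Set.Ioo t q ⊆ Set.Ioo (-q) q := Set.Ioo_subset_Ioo_left ht.1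
    obtain ⟨c, hc, hslope⟩ := exists_hasDerivAt_eq_slope (Del β h q) d ht.2
      ((continuousOn_Del hq0).mono (Set.Icc_subset_Icc_left ht.1))
      (fun x hx => (hd x (hsub hx)).1)
    have hlt := (hd c (hsub hc)).2.2
    rw [hslope, hself, div_lt_one (by linarith [ht.2])] at hlt
    linarith

end CT
end
end

section
/- Fix k ≥ 2 and distinct indices i, τ, ι ∈ [n] with τ, ι ≠ i and τ ≠ ι. For any 1 ≤ r, r′ ≤ k−1, any pair (s,t) satisfying either (t = s = 0) or (1 ≤ s ≤ min(k−r, k−r′) and s+1 ≤ t ≤ min(2s, k−r+1, k−r′+1)), and any 0 ≤ ℓ ≤ t with ℓ ≤ 2, if the set I_{τ,ι,r,r′}(s,t,ℓ) is nonempty, then t − ℓ ≤ min(k−r−1, k−r′−1), and there exists a constant C = C(k,r,r′,t,ℓ) > 0 independent of n such that |I_{τ,ι,r,r′}(s,t,ℓ)| ≤ C n^{2k−r−r′−t+ℓ−2}. -/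
open Finset

noncomputable section

namespace CT

/-- self-avoiding paths `(τ_k, τ_{k−1}, …, τ_r, τ_{r−1})` starting at `τ` whose second
vertex differs from `i`, recorded as injective tuples `p : Fin (k − r + 2) → Fin n` with
`p 0 = τ_k = τ` and `p (k−r+1) = τ_{r−1}`. -/
def pathSet (n k r : ℕ) (i τ : Fin n) : Set (Fin (k - r + 2) → Fin n) :=
  {p | Function.Injective p ∧ p 0 = τ ∧ p 1 ≠ i}

/-- the edges of a path, as unordered pairs of consecutive vertices. -/
def pathEdges {n m : ℕ} (p : Fin (m + 2) → Fin n) : Set (Sym2 (Fin n)) :=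
  {e | ∃ s : Fin (m + 1), e = s(p s.castSucc, p s.succ)}

/-- vertices appearing among a set of edges. -/
def edgeVerts {n : ℕ} (E : Set (Sym2 (Fin n))) : Set (Fin n) :=
  {v | ∃ e ∈ E, v ∈ e}

/-- the collection `I_{τ,ι,r,r′}(s,t,ℓ)` of pairs of self-avoiding paths: both paths are
self-avoiding, one of the cases (A)–(D) holds for their two last edges, exactly `s`
edges are shared, the shared edges span exactly `t` vertices, and exactly `ℓ` of the two
vertices `τ, τ_r` appear among the shared edges. -/
def pairSet (n k r r' s t ℓ : ℕ) (i τ ι : Fin n) :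
    Set ((Fin (k - r + 2) → Fin n) × (Fin (k - r' + 2) → Fin n)) :=
  {pq | pq.1 ∈ pathSet n k r i τ ∧ pq.2 ∈ pathSet n k r' i ι ∧
    (((pq.1 ⟨k - r, by omega⟩ = i ∧ pq.1 (Fin.last (k - r + 1)) = ι) ∧
        (pq.2 ⟨k - r', by omega⟩ = i ∧ pq.2 (Fin.last (k - r' + 1)) = τ)) ∨
     ((pq.1 ⟨k - r, by omega⟩ = i ∧ pq.1 (Fin.last (k - r + 1)) = ι) ∧
        (pq.2 ⟨k - r', by omega⟩ = τ ∧ pq.2 (Fin.last (k - r' + 1)) = i)) ∨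
     ((pq.1 ⟨k - r, by omega⟩ = ι ∧ pq.1 (Fin.last (k - r + 1)) = i) ∧
        (pq.2 ⟨k - r', by omega⟩ = i ∧ pq.2 (Fin.last (k - r' + 1)) = τ)) ∨
     ((pq.1 ⟨k - r, by omega⟩ = ι ∧ pq.1 (Fin.last (k - r + 1)) = i) ∧
        (pq.2 ⟨k - r', by omega⟩ = τ ∧ pq.2 (Fin.last (k - r' + 1)) = i))) ∧
    (pathEdges pq.1 ∩ pathEdges pq.2).ncard = s ∧
    (edgeVerts (pathEdges pq.1 ∩ pathEdges pq.2)).ncard = t ∧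
    (({τ, pq.1 ⟨k - r, by omega⟩} : Set (Fin n)) ∩
      edgeVerts (pathEdges pq.1 ∩ pathEdges pq.2)).ncard = ℓ}

/-- the admissible range (6.10) of the pair `(s, t)`. -/
def stCond (k r r' s t : ℕ) : Prop :=
  (t = 0 ∧ s = 0) ∨
    (1 ≤ s ∧ s ≤ min (k - r) (k - r') ∧
      s + 1 ≤ t ∧ t ≤ min (2 * s) (min (k - r + 1) (k - r' + 1)))

/-- the vertices of a path other than its first and its last two. -/
def innerVerts {n m : ℕ} (p : Fin (m + 2) → Fin n) : Finset (Fin n) :=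
  (univ \ {0, ⟨m, by omega⟩, Fin.last (m + 1)}).image p

theorem mem_innerVerts {n m : ℕ} {p : Fin (m + 2) → Fin n} {j : Fin (m + 2)} (h0 : j ≠ 0)
    (hm : j ≠ ⟨m, by omega⟩) (hl : j ≠ Fin.last (m + 1)) : p j ∈ innerVerts p :=
  mem_image_of_mem p (by simp [h0, hm, hl])

theorem card_innerVerts_le {n m : ℕ} (hm : 1 ≤ m) (p : Fin (m + 2) → Fin n) :
    (innerVerts p).card ≤ m - 1 := by
  refine card_image_le.trans ?_
  rw [card_sdiff_of_subset (subset_univ _), card_univ, Fintype.card_fin, card_eq_three.2]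
  · omega
  · refine ⟨_, _, _, ?_, ?_, ?_, rfl⟩ <;> simp [Fin.ext_iff]
    omega

theorem exists_eq_of_mem_edgeVerts {n m : ℕ} {p : Fin (m + 2) → Fin n}
    {E : Set (Sym2 (Fin n))} (hE : E ⊆ pathEdges p) {v : Fin n} (hv : v ∈ edgeVerts E) :
    ∃ j, v = p j := by
  obtain ⟨e, he, hve⟩ := hv
  obtain ⟨a, rfl⟩ := hE he
  rcases Sym2.mem_iff.1 hve with h | h
  exacts [⟨_, h⟩, ⟨_, h⟩]

theorem eq_of_head_mem {n m : ℕ} {p : Fin (m + 2) → Fin n} (hp : Function.Injective p)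
    {e : Sym2 (Fin n)} (he : e ∈ pathEdges p) (h : p 0 ∈ e) : e = s(p 0, p 1) := by
  obtain ⟨a, rfl⟩ := he
  rcases Sym2.mem_iff.1 h with h | h
  · have ha : a = 0 := Fin.ext (Fin.ext_iff.1 (hp h)).symm
    subst ha
    rfl
  · exact absurd (hp h).symm (Fin.succ_ne_zero a)

theorem eq_of_last_mem {n m : ℕ} {p : Fin (m + 2) → Fin n} (hp : Function.Injective p)
    {e : Sym2 (Fin n)} (he : e ∈ pathEdges p) (h : p (Fin.last (m + 1)) ∈ e) :
    e = s(p ⟨m, by omega⟩, p (Fin.last (m + 1))) := by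
  obtain ⟨a, rfl⟩ := he
  rcases Sym2.mem_iff.1 h with h | h
  · exact absurd (hp h).symm (Fin.castSucc_lt_last a).ne
  · have ha : a = Fin.last m := Fin.succ_injective _ (hp h).symm
    subst ha
    rfl

theorem last_notMem_edgeVerts {n m m' : ℕ} {p : Fin (m + 2) → Fin n} {q : Fin (m' + 2) → Fin n}
    {i : Fin n} (hp : Function.Injective p) (hq : Function.Injective q) (hq1 : q 1 ≠ i)
    (hi : i ≠ q 0)
    (h : (p ⟨m, by omega⟩ = i ∧ p (Fin.last (m + 1)) = q 0) ∨
      (p ⟨m, by omega⟩ = q 0 ∧ p (Fin.last (m + 1)) = i)) :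
    p (Fin.last (m + 1)) ∉ edgeVerts (pathEdges p ∩ pathEdges q) := by
  rintro ⟨e, ⟨hep, heq⟩, he⟩
  have h1 := eq_of_last_mem hp hep he
  have h2 : e = s(i, q 0) := by
    rcases h with ⟨ha, hb⟩ | ⟨ha, hb⟩
    · rw [h1, ha, hb]
    · rw [h1, ha, hb, Sym2.eq_swap]
  have h3 := eq_of_head_mem hq heq (by simp [h2])
  rw [h2, Sym2.eq_iff] at h3
  rcases h3 with ⟨h3, -⟩ | ⟨h3, -⟩
  exacts [hi h3, hq1 h3.symm]

/-- two paths from `p 0` and `q 0` ending with the edges `{i, q 0}` and `{i, p 0}`. -/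
structure CrossedPair {n m m' : ℕ} (i : Fin n) (p : Fin (m + 2) → Fin n)
    (q : Fin (m' + 2) → Fin n) : Prop where
  inj_left : Function.Injective p
  inj_right : Function.Injective q
  second_left : p 1 ≠ i
  second_right : q 1 ≠ i
  ne_left : i ≠ p 0
  ne_right : i ≠ q 0
  last_left : (p ⟨m, by omega⟩ = i ∧ p (Fin.last (m + 1)) = q 0) ∨
    (p ⟨m, by omega⟩ = q 0 ∧ p (Fin.last (m + 1)) = i)
  last_right : (q ⟨m', by omega⟩ = i ∧ q (Fin.last (m' + 1)) = p 0) ∨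
    (q ⟨m', by omega⟩ = p 0 ∧ q (Fin.last (m' + 1)) = i)

namespace CrossedPair

variable {n m m' : ℕ} {i : Fin n} {p : Fin (m + 2) → Fin n} {q : Fin (m' + 2) → Fin n}

theorem symm (h : CrossedPair i p q) : CrossedPair i q p :=
  ⟨h.2, h.1, h.4, h.3, h.6, h.5, h.8, h.7⟩

theorem apply_mem_innerVerts (h : CrossedPair i p q) (j : Fin (m + 2)) :
    p j ∈ innerVerts p ∨ p j = i ∨ p j = p 0 ∨ p j = q 0 := by
  by_cases h0 : j = 0
  · simp [h0]
  by_cases hm : j = ⟨m, by omega⟩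
  · subst hm; rcases h.last_left with h | h <;> simp [h.1]
  by_cases hl : j = Fin.last (m + 1)
  · subst hl; rcases h.last_left with h | h <;> simp [h.2]
  exact Or.inl (mem_innerVerts h0 hm hl)

theorem last_left_notMem (h : CrossedPair i p q) :
    p (Fin.last (m + 1)) ∉ edgeVerts (pathEdges p ∩ pathEdges q) :=
  last_notMem_edgeVerts h.inj_left h.inj_right h.second_right h.ne_right h.last_left

theorem last_right_notMem (h : CrossedPair i p q) :
    q (Fin.last (m' + 1)) ∉ edgeVerts (pathEdges p ∩ pathEdges q) := by
  rw [Set.inter_comm]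
  exact h.symm.last_left_notMem

theorem shared_subset_left (h : CrossedPair i p q) :
    edgeVerts (pathEdges p ∩ pathEdges q) \ {p 0, p ⟨m, by omega⟩} ⊆ ↑(innerVerts p) := by
  rintro v ⟨hv, hne⟩
  obtain ⟨j, rfl⟩ := exists_eq_of_mem_edgeVerts Set.inter_subset_left hv
  refine mem_innerVerts ?_ ?_ ?_ <;> rintro rfl
  · exact hne (by simp)
  · exact hne (by simp)
  · exact h.last_left_notMem hv

theorem shared_subset_right (h : CrossedPair i p q) :
    edgeVerts (pathEdges p ∩ pathEdges q) \ {p 0, p ⟨m, by omega⟩} ⊆ ↑(innerVerts q) := by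
  rintro v ⟨hv, hne⟩
  obtain ⟨j, rfl⟩ := exists_eq_of_mem_edgeVerts Set.inter_subset_right hv
  have hl := h.last_left_notMem
  refine mem_innerVerts ?_ ?_ ?_ <;> rintro rfl
  · rcases h.last_left with ⟨ha, hb⟩ | ⟨ha, hb⟩
    · exact hl (hb ▸ hv)
    · exact hne (by simp [ha])
  · rcases h.last_right with ⟨hc, -⟩ | ⟨hc, -⟩
    · rcases h.last_left with ⟨ha, hb⟩ | ⟨ha, hb⟩
      · exact hne (by simp [ha, hc])
      · exact hl (by rw [hb, ← hc]; exact hv)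
    · exact hne (by simp [hc])
  · exact h.last_right_notMem hv

end CrossedPair

theorem crossedPair_of_mem {n k r r' s t ℓ : ℕ} {i τ ι : Fin n} (hτ : i ≠ τ) (hι : i ≠ ι)
    {pq : (Fin (k - r + 2) → Fin n) × (Fin (k - r' + 2) → Fin n)}
    (h : pq ∈ pairSet n k r r' s t ℓ i τ ι) : CrossedPair i pq.1 pq.2 := by
  obtain ⟨⟨hp, hp0, hp1⟩, ⟨hq, hq0, hq1⟩, hc, -⟩ := h
  refine ⟨hp, hq, hp1, hq1, hp0 ▸ hτ, hq0 ▸ hι, ?_, ?_⟩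
  · rw [hq0]; tauto
  · rw [hp0]; tauto

theorem ncard_shared_diff {n k r r' s t ℓ : ℕ} {i τ ι : Fin n}
    {pq : (Fin (k - r + 2) → Fin n) × (Fin (k - r' + 2) → Fin n)}
    (h : pq ∈ pairSet n k r r' s t ℓ i τ ι) :
    (edgeVerts (pathEdges pq.1 ∩ pathEdges pq.2) \
      {pq.1 0, pq.1 ⟨k - r, by omega⟩}).ncard = t - ℓ := by
  obtain ⟨⟨-, hp0, -⟩, -, -, -, ht, hℓ⟩ := h
  have := Set.ncard_inter_add_ncard_sdiff_eq_ncard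
    (edgeVerts (pathEdges pq.1 ∩ pathEdges pq.2)) {pq.1 0, pq.1 ⟨k - r, by omega⟩}
    (Set.toFinite _)
  rw [hp0, Set.inter_comm, hℓ, ht] at this
  rw [hp0]
  omega

theorem sub_le_card_inter {n k r r' s t ℓ : ℕ} {i τ ι : Fin n} (hτ : i ≠ τ) (hι : i ≠ ι)
    {pq : (Fin (k - r + 2) → Fin n) × (Fin (k - r' + 2) → Fin n)}
    (h : pq ∈ pairSet n k r r' s t ℓ i τ ι) :
    t - ℓ ≤ (innerVerts pq.1 ∩ innerVerts pq.2).card := by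
  have hc := crossedPair_of_mem hτ hι h
  rw [← ncard_shared_diff h, ← Set.ncard_coe_finset]
  refine Set.ncard_le_ncard ?_ (Set.toFinite _)
  rw [coe_inter]
  exact Set.subset_inter hc.shared_subset_left hc.shared_subset_right

theorem exists_subset_range {α : Type*} [Nonempty α] (X : Finset α) {N : ℕ} (hX : X.card ≤ N) :
    ∃ g : Fin N → α, ↑X ⊆ Set.range g := by
  refine ⟨fun j => X.toList.getD j (Classical.arbitrary α), fun x hx => ?_⟩
  obtain ⟨j, hj, rfl⟩ := List.getElem_of_mem (mem_toList.2 (mem_coe.1 hx))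
  refine ⟨⟨j, ?_⟩, ?_⟩
  · rw [length_toList] at hj
    omega
  · exact List.getD_eq_getElem _ _ hj

/-- pairs of functions with values in three given points and at most `N` further ones. -/
theorem ncard_le_of_subset_range {α β γ : Type*} [Fintype α] [Fintype β] [Fintype γ]
    (c : Fin 3 → γ) (N : ℕ) (S : Set ((α → γ) × (β → γ)))
    (hS : ∀ f ∈ S, ∃ g : Fin N → γ, Set.range f.1 ⊆ Set.range (Sum.elim g c) ∧
      Set.range f.2 ⊆ Set.range (Sum.elim g c)) :
    S.ncard ≤ (N + 3) ^ (Fintype.card α + Fintype.card β) * Fintype.card γ ^ N := by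
  classical
  let F : ((α → Fin N ⊕ Fin 3) × (β → Fin N ⊕ Fin 3)) × (Fin N → γ) → (α → γ) × (β → γ) :=
    fun x => (Sum.elim x.2 c ∘ x.1.1, Sum.elim x.2 c ∘ x.1.2)
  have hsub : S ⊆ F '' Set.univ := by
    rintro ⟨f₁, f₂⟩ hf
    obtain ⟨g, h₁, h₂⟩ := hS _ hf
    choose a ha using fun x => h₁ ⟨x, rfl⟩
    choose b hb using fun x => h₂ ⟨x, rfl⟩
    exact ⟨((a, b), g), trivial, Prod.ext (funext ha) (funext hb)⟩
  refine (Set.ncard_le_ncard hsub (Set.toFinite _)).trans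
    ((Set.ncard_image_le (Set.toFinite _)).trans ?_)
  simp [Set.ncard_univ, pow_add]

theorem ncard_pairSet_le {n k r r' s t ℓ : ℕ} {i τ ι : Fin n} (hτ : i ≠ τ) (hι : i ≠ ι)
    (hr : 1 ≤ k - r) (hr' : 1 ≤ k - r') :
    (pairSet n k r r' s t ℓ i τ ι).ncard ≤
      ((k - r - 1) + (k - r' - 1) - (t - ℓ) + 3) ^ ((k - r + 2) + (k - r' + 2)) *
        n ^ ((k - r - 1) + (k - r' - 1) - (t - ℓ)) := by
  have : Nonempty (Fin n) := ⟨i⟩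
  refine (ncard_le_of_subset_range ![i, τ, ι] ((k - r - 1) + (k - r' - 1) - (t - ℓ)) _
    fun pq h => ?_).trans_eq (by simp)
  have hc := crossedPair_of_mem hτ hι h
  have hcard := sub_le_card_inter hτ hι h
  have hu := card_union_add_card_inter (innerVerts pq.1) (innerVerts pq.2)
  have h₁ := card_innerVerts_le hr pq.1
  have h₂ := card_innerVerts_le hr' pq.2
  obtain ⟨g, hg⟩ := exists_subset_range (innerVerts pq.1 ∪ innerVerts pq.2)
    (N := (k - r - 1) + (k - r' - 1) - (t - ℓ)) (by omega)
  obtain ⟨⟨-, hp0, -⟩, ⟨-, hq0, -⟩, -⟩ := h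
  have key : ∀ v, v ∈ innerVerts pq.1 ∪ innerVerts pq.2 ∨ v = i ∨ v = τ ∨ v = ι →
      v ∈ Set.range (Sum.elim g ![i, τ, ι]) := by
    rintro v (hv | rfl | rfl | rfl)
    · obtain ⟨j, rfl⟩ := hg hv
      exact ⟨Sum.inl j, rfl⟩
    exacts [⟨Sum.inr 0, rfl⟩, ⟨Sum.inr 1, rfl⟩, ⟨Sum.inr 2, rfl⟩]
  refine ⟨g, ?_, ?_⟩ <;> rintro _ ⟨j, rfl⟩ <;> apply key
  · rcases hc.apply_mem_innerVerts j with h | h | h | h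
    exacts [Or.inl (mem_union_left _ h), Or.inr (Or.inl h),
      Or.inr (Or.inr (Or.inl (h.trans hp0))), Or.inr (Or.inr (Or.inr (h.trans hq0)))]
  · rcases hc.symm.apply_mem_innerVerts j with h | h | h | h
    exacts [Or.inl (mem_union_right _ h), Or.inr (Or.inl h),
      Or.inr (Or.inr (Or.inr (h.trans hq0))), Or.inr (Or.inr (Or.inl (h.trans hp0)))]

/-- **Lemma 6.2.** For `1 ≤ r, r' ≤ k − 1`, admissible `(s,t)` and `0 ≤ ℓ ≤ min(t, 2)`:
if `I_{τ,ι,r,r′}(s,t,ℓ)` is nonempty then `t − ℓ ≤ min(k−r−1, k−r′−1)`, and there is a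
constant `C = C(k,r,r′,t,ℓ) > 0` independent of `n` with
`|I_{τ,ι,r,r′}(s,t,ℓ)| ≤ C n^{2k−r−r′−t+ℓ−2}`. -/
theorem path_pair_count (k r r' t ℓ : ℕ) (hk : 2 ≤ k)
    (hr : 1 ≤ r) (hrk : r ≤ k - 1) (hr' : 1 ≤ r') (hr'k : r' ≤ k - 1)
    (hℓ2 : ℓ ≤ 2) (hℓt : ℓ ≤ t) :
    (∀ (n s : ℕ) (i τ ι : Fin n), i ≠ τ → i ≠ ι → τ ≠ ι → stCond k r r' s t →
      (pairSet n k r r' s t ℓ i τ ι).Nonempty →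
      t - ℓ ≤ min (k - r - 1) (k - r' - 1)) ∧
    ∃ C > 0, ∀ (n s : ℕ) (i τ ι : Fin n), i ≠ τ → i ≠ ι → τ ≠ ι → stCond k r r' s t →
      (pairSet n k r r' s t ℓ i τ ι).Nonempty →
      ((pairSet n k r r' s t ℓ i τ ι).ncard : ℝ)
        ≤ C * (n : ℝ) ^ (2 * (k : ℤ) - r - r' - t + ℓ - 2) := by
  have h₁ : 1 ≤ k - r := by omega
  have h₂ : 1 ≤ k - r' := by omega
  have hbound : ∀ (n s : ℕ) (i τ ι : Fin n), i ≠ τ → i ≠ ι →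
      (pairSet n k r r' s t ℓ i τ ι).Nonempty → t - ℓ ≤ min (k - r - 1) (k - r' - 1) := by
    rintro n s i τ ι hτ hι ⟨pq, h⟩
    have h := sub_le_card_inter hτ hι h
    exact le_min
      (h.trans ((card_le_card inter_subset_left).trans (card_innerVerts_le h₁ _)))
      (h.trans ((card_le_card inter_subset_right).trans (card_innerVerts_le h₂ _)))
  refine ⟨fun n s i τ ι hτ hι _ _ hne => hbound n s i τ ι hτ hι hne,
    (((k - r - 1) + (k - r' - 1) - (t - ℓ) + 3) ^ ((k - r + 2) + (k - r' + 2)) : ℕ),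
    by positivity, fun n s i τ ι hτ hι _ _ hne => ?_⟩
  have hle := hbound n s i τ ι hτ hι hne
  have hexp : 2 * (k : ℤ) - r - r' - t + ℓ - 2 =
      (((k - r - 1) + (k - r' - 1) - (t - ℓ) : ℕ) : ℤ) := by omega
  rw [hexp, zpow_natCast]
  exact_mod_cast ncard_pairSet_le hτ hι h₁ h₂

end CT
end
end
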